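/- arXiv:2002.02442 — 5 statements merged into one kernel-verified Lean document; each statement's English description precedes it below -/
import Mathlib

section
/- Let v ≥ 0 be an integer and let ξ = c + d·X ∈ Λ₁, where c ∈ ℤ_p has p-adic valuation exactly ν + v and d ∈ ℤ_p is a unit. Then the quotient ring Λ₁/(ξ) is isomorphic, as a ring, to ℤ/p^{2ν+v}ℤ; explicitly, the ℤ_p-algebra map Λ₁ → ℤ/p^{2ν+v}ℤ sending X to the class of −c·d^{−1} is well defined, surjective, and has kernel the principal ideal (ξ). -/
/-- The ring `Λ₁ = ℤ_p[X]/(X², p^ν X)`. -/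
noncomputable abbrev Lambda1 (p : ℕ) [Fact p.Prime] (ν : ℕ) : Type :=
  (Polynomial ℤ_[p]) ⧸
    (Ideal.span {(Polynomial.X : Polynomial ℤ_[p]) ^ 2,
      (p : Polynomial ℤ_[p]) ^ ν * Polynomial.X})

/-- The image of the polynomial variable `X` in `Λ₁`. -/
noncomputable abbrev Lambda1X (p : ℕ) [Fact p.Prime] (ν : ℕ) : Lambda1 p ν :=
  Ideal.Quotient.mk _ Polynomial.X

namespace PadicInt

/-- A `p`-adic integer of norm `p ^ (-n)` is a unit times `p ^ n`. -/
theorem exists_unit_mul_pow_of_norm_eq {p : ℕ} [Fact p.Prime] {x : ℤ_[p]} {n : ℕ}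
    (hx : ‖x‖ = (p : ℝ) ^ (-(n : ℤ))) : ∃ u : ℤ_[p]ˣ, x = u * (p : ℤ_[p]) ^ n := by
  have hp : (1 : ℝ) < p := mod_cast (Fact.out : p.Prime).one_lt
  have hx0 : x ≠ 0 := by
    rintro rfl
    rw [norm_zero] at hx
    exact (zpow_pos (zero_lt_one.trans hp) _).ne hx
  have hn : x.valuation = n := by
    have h := zpow_right_injective₀ (zero_lt_one.trans hp) hp.ne'
      ((norm_eq_zpow_neg_valuation hx0).symm.trans hx)
    exact Nat.cast_injective (neg_injective h)
  exact ⟨unitCoeff hx0, hn ▸ unitCoeff_spec hx0⟩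

end PadicInt

/-- If `ξ = c + d·X ∈ Λ₁` where `c ∈ ℤ_p` has `p`-adic valuation exactly
`ν + v` and `d ∈ ℤ_p` is a unit, then `Λ₁/(ξ) ≅ ℤ/p^{2ν+v}ℤ` as rings; explicitly, the
`ℤ_p`-algebra map `Λ₁ → ℤ/p^{2ν+v}ℤ` sending `X` to the class of `−c·d⁻¹` is well
defined, surjective, and has kernel the principal ideal `(ξ)`. -/
theorem Lambda1_quotient_iso_ZMod (p : ℕ) [Fact p.Prime] (ν : ℕ) (hν : 1 ≤ ν)
    (v : ℕ) (c : ℤ_[p]) (hc : ‖c‖ = (p : ℝ) ^ (-((ν + v : ℕ) : ℤ))) (d : ℤ_[p]ˣ)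
    (ξ : Lambda1 p ν)
    (hξ : ξ = algebraMap ℤ_[p] (Lambda1 p ν) c
      + algebraMap ℤ_[p] (Lambda1 p ν) (d : ℤ_[p]) * Lambda1X p ν) :
    Nonempty ((Lambda1 p ν ⧸ Ideal.span {ξ}) ≃+* ZMod (p ^ (2 * ν + v))) ∧
    ∃ ψ : Lambda1 p ν →+* ZMod (p ^ (2 * ν + v)),
      (∀ z : ℤ_[p], ψ (algebraMap ℤ_[p] (Lambda1 p ν) z)
          = PadicInt.toZModPow (2 * ν + v) z) ∧
      ψ (Lambda1X p ν) = PadicInt.toZModPow (2 * ν + v) (-c * ((d⁻¹ : ℤ_[p]ˣ) : ℤ_[p])) ∧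
      Function.Surjective ψ ∧
      RingHom.ker ψ = Ideal.span {ξ} := by
  set N := 2 * ν + v with hN
  set a : ℤ_[p] := -c * ((d⁻¹ : ℤ_[p]ˣ) : ℤ_[p]) with ha
  obtain ⟨u, hu⟩ := PadicInt.exists_unit_mul_pow_of_norm_eq hc
  have hmk (z : ℤ_[p]) :
      algebraMap ℤ_[p] (Lambda1 p ν) z = Ideal.Quotient.mk _ (Polynomial.C z) := rfl
  have hda : (d : ℤ_[p]) * a = -c := by
    rw [ha, mul_left_comm, Units.mul_inv, mul_one]
  have hξX : ξ = algebraMap ℤ_[p] (Lambda1 p ν) d *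
      Ideal.Quotient.mk _ (Polynomial.X - Polynomial.C a) := by
    rw [hξ, map_sub, ← hmk, mul_sub, ← map_mul, hda, map_neg]
    ring
  have hpX : (Ideal.Quotient.mk _ ((p : Polynomial ℤ_[p]) ^ ν * Polynomial.X) : Lambda1 p ν) = 0 :=
    Ideal.Quotient.eq_zero_iff_mem.2 (Ideal.subset_span (by simp))
  have hpN : algebraMap ℤ_[p] (Lambda1 p ν) ((p : ℤ_[p]) ^ N) ∈ Ideal.span {ξ} := by
    refine Ideal.mem_span_singleton'.2
      ⟨algebraMap ℤ_[p] (Lambda1 p ν) (((u⁻¹ : ℤ_[p]ˣ) : ℤ_[p]) * (p : ℤ_[p]) ^ ν), ?_⟩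
    have hpX' : algebraMap ℤ_[p] (Lambda1 p ν) ((p : ℤ_[p]) ^ ν) * Lambda1X p ν = 0 := by
      rw [← hpX, hmk, ← map_mul]
      simp
    have hpc : ((u⁻¹ : ℤ_[p]ˣ) : ℤ_[p]) * (p : ℤ_[p]) ^ ν * c = (p : ℤ_[p]) ^ N := by
      rw [hu, hN]
      calc _ = (((u⁻¹ : ℤ_[p]ˣ) : ℤ_[p]) * u) * (p : ℤ_[p]) ^ (2 * ν + v) := by ring
        _ = _ := by rw [Units.inv_mul, one_mul]
    rw [hξ, mul_add, ← map_mul, hpc, map_mul, add_eq_left]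
    linear_combination (algebraMap ℤ_[p] (Lambda1 p ν) ((u⁻¹ : ℤ_[p]ˣ) : ℤ_[p]) *
      algebraMap ℤ_[p] (Lambda1 p ν) d) * hpX'
  have hker (z : ℤ_[p]) : PadicInt.toZModPow N z = 0 ↔ (p : ℤ_[p]) ^ N ∣ z := by
    rw [← RingHom.mem_ker, PadicInt.ker_toZModPow, Ideal.mem_span_singleton]
  have hpa : (p : ℤ_[p]) ^ (ν + v) ∣ a :=
    Dvd.dvd.mul_right ((dvd_neg).2 (hu ▸ Dvd.intro_left _ rfl)) _
  let φ : Polynomial ℤ_[p] →+* ZMod (p ^ N) :=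
    (PadicInt.toZModPow N).comp (Polynomial.evalRingHom a)
  have hφ (f : Polynomial ℤ_[p]) : φ f = PadicInt.toZModPow N (f.eval a) := rfl
  have hle : Ideal.span {(Polynomial.X : Polynomial ℤ_[p]) ^ 2,
      (p : Polynomial ℤ_[p]) ^ ν * Polynomial.X} ≤ RingHom.ker φ := by
    rw [Ideal.span_le]
    rintro f (rfl | rfl)
    · rw [SetLike.mem_coe, RingHom.mem_ker, hφ, hker, Polynomial.eval_pow, Polynomial.eval_X]
      refine (pow_dvd_pow (p : ℤ_[p]) (show N ≤ (ν + v) * 2 by omega)).trans ?_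
      rw [pow_mul]
      exact pow_dvd_pow_of_dvd hpa 2
    · rw [SetLike.mem_coe, RingHom.mem_ker, hφ, hker, Polynomial.eval_mul, Polynomial.eval_X,
        Polynomial.eval_pow, Polynomial.eval_natCast,
        show N = ν + (ν + v) by omega, pow_add]
      exact mul_dvd_mul_left _ hpa
  let ψ : Lambda1 p ν →+* ZMod (p ^ N) := Ideal.Quotient.lift _ φ fun f hf => hle hf
  have hψ (f : Polynomial ℤ_[p]) :
      ψ (Ideal.Quotient.mk _ f) = PadicInt.toZModPow N (f.eval a) := rfl
  have hψC (z : ℤ_[p]) :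
      ψ (algebraMap ℤ_[p] (Lambda1 p ν) z) = PadicInt.toZModPow N z := by
    rw [hmk, hψ, Polynomial.eval_C]
  have hsurj : Function.Surjective ψ := fun y =>
    (ZMod.ringHom_surjective (PadicInt.toZModPow N) y).imp' _ fun z hz => (hψC z).trans hz
  have hkerψ : RingHom.ker ψ = Ideal.span {ξ} := by
    apply le_antisymm
    · intro x hx
      obtain ⟨f, rfl⟩ := Ideal.Quotient.mk_surjective x
      rw [RingHom.mem_ker, hψ, hker] at hx
      obtain ⟨t, ht⟩ := hx
      obtain ⟨g, hg⟩ := Polynomial.X_sub_C_dvd_sub_C_eval (a := a) (p := f)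
      have hXa : (Ideal.Quotient.mk _ (Polynomial.X - Polynomial.C a) : Lambda1 p ν) ∈
          Ideal.span {ξ} := by
        refine Ideal.mem_span_singleton'.2
          ⟨algebraMap ℤ_[p] (Lambda1 p ν) ((d⁻¹ : ℤ_[p]ˣ) : ℤ_[p]), ?_⟩
        rw [hξX, ← mul_assoc, ← map_mul, Units.inv_mul, map_one, one_mul]
      rw [← sub_add_cancel f (Polynomial.C (f.eval a)), hg, map_add,
        map_mul (Ideal.Quotient.mk _), ← hmk, ht, map_mul (algebraMap _ _)]
      exact add_mem (Ideal.mul_mem_right _ _ hXa) (Ideal.mul_mem_right _ _ hpN)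
    · rw [Ideal.span_singleton_le_iff_mem, RingHom.mem_ker, hξX, map_mul, hψ]
      simp
  exact ⟨⟨(Ideal.quotEquivOfEq hkerψ.symm).trans
    (RingHom.quotientKerEquivOfSurjective hsurj)⟩, ψ, hψC,
    by rw [hψ, Polynomial.eval_X], hsurj, hkerψ⟩
end

section
/- Let v ≥ 0 be an integer and let ξ = c + d·X ∈ Λ₁, where c ∈ ℤ_p has p-adic valuation exactly ν + v and d ∈ ℤ_p is arbitrary. Then the quotient ring Λ₁/(ξ) is annihilated by p^{2ν+v}; in particular Λ₁/(ξ) is a finite ring. -/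
/-- Every element of `Λ₁` has the form `a + b * X`. -/
theorem Lambda1_exists_eq_add_mul_X (p : ℕ) [Fact p.Prime] (ν : ℕ) (y : Lambda1 p ν) :
    ∃ a b : ℤ_[p], y = algebraMap ℤ_[p] (Lambda1 p ν) a
      + algebraMap ℤ_[p] (Lambda1 p ν) b * Lambda1X p ν := by
  obtain ⟨f, rfl⟩ := Ideal.Quotient.mk_surjective y
  refine ⟨f.coeff 0, f.divX.coeff 0, ?_⟩
  rw [← sub_eq_zero]
  change Ideal.Quotient.mk _ (f - (Polynomial.C (f.coeff 0)
    + Polynomial.C (f.divX.coeff 0) * Polynomial.X)) = 0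
  rw [Ideal.Quotient.eq_zero_iff_mem]
  have hf : f - (Polynomial.C (f.coeff 0) + Polynomial.C (f.divX.coeff 0) * Polynomial.X)
      = f.divX.divX * Polynomial.X ^ 2 := by
    linear_combination (-1 : Polynomial ℤ_[p]) * Polynomial.divX_mul_X_add f
      - Polynomial.X * Polynomial.divX_mul_X_add f.divX
  rw [hf]
  exact Ideal.mul_mem_left _ _ (Ideal.subset_span (by simp))

theorem Lambda1_pow_mul_X (p : ℕ) [Fact p.Prime] (ν : ℕ) :
    (p : Lambda1 p ν) ^ ν * Lambda1X p ν = 0 := by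
  change Ideal.Quotient.mk _ ((p : Polynomial ℤ_[p]) ^ ν * Polynomial.X) = 0
  rw [Ideal.Quotient.eq_zero_iff_mem]
  exact Ideal.subset_span (by simp)

theorem PadicInt.exists_unit_of_norm_eq {p : ℕ} [Fact p.Prime] {n : ℕ} {c : ℤ_[p]}
    (hc : ‖c‖ = (p : ℝ) ^ (-(n : ℤ))) : ∃ u : ℤ_[p]ˣ, c = u * (p : ℤ_[p]) ^ n := by
  have hp : (p : ℝ) ≠ 0 := by exact_mod_cast (Fact.out : p.Prime).ne_zero
  obtain ⟨w, rfl⟩ := Ideal.mem_span_singleton'.mp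
    ((PadicInt.norm_le_pow_iff_mem_span_pow c n).mp hc.le)
  rw [norm_mul, PadicInt.norm_p_pow] at hc
  have hw : IsUnit w := PadicInt.isUnit_iff.mpr
    (mul_right_cancel₀ (zpow_ne_zero _ hp) (hc.trans (one_mul _).symm))
  exact ⟨hw.unit, rfl⟩

/-- A `ℤ_p`-algebra in which `p ^ N = 0` and which is generated as a module by `1` and `x` is
finite. -/
theorem PadicInt.finite_of_pow_eq_zero {p : ℕ} [Fact p.Prime] {R : Type*} [CommRing R]
    (φ : ℤ_[p] →+* R) (x : R) (N : ℕ) (hN : (p : R) ^ N = 0)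
    (hx : ∀ y : R, ∃ a b : ℤ_[p], y = φ a + φ b * x) : Finite R := by
  have happr (a : ℤ_[p]) : φ a = (a.appr N : R) := by
    obtain ⟨t, ht⟩ := Ideal.mem_span_singleton'.mp (PadicInt.appr_spec N a)
    have h := congrArg φ ht
    simp only [map_mul, map_pow, map_natCast, map_sub, hN, mul_zero] at h
    exact sub_eq_zero.mp h.symm
  refine Finite.of_surjective
    (fun m : Fin (p ^ N) × Fin (p ^ N) => ((m.1 : ℕ) : R) + ((m.2 : ℕ) : R) * x) fun y => ?_
  obtain ⟨a, b, rfl⟩ := hx y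
  exact ⟨(⟨a.appr N, a.appr_lt N⟩, ⟨b.appr N, b.appr_lt N⟩), by simp only [happr]⟩

/-- If `ξ = c + d·X ∈ Λ₁` where `c ∈ ℤ_p` has `p`-adic valuation exactly
`ν + v` and `d ∈ ℤ_p` is arbitrary, then the quotient ring `Λ₁/(ξ)` is annihilated
by `p^{2ν+v}`; in particular it is a finite ring. -/
theorem Lambda1_quotient_annihilated (p : ℕ) [Fact p.Prime] (ν : ℕ) (hν : 1 ≤ ν)
    (v : ℕ) (c : ℤ_[p]) (hc : ‖c‖ = (p : ℝ) ^ (-((ν + v : ℕ) : ℤ))) (d : ℤ_[p])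
    (ξ : Lambda1 p ν)
    (hξ : ξ = algebraMap ℤ_[p] (Lambda1 p ν) c
      + algebraMap ℤ_[p] (Lambda1 p ν) d * Lambda1X p ν) :
    (∀ y : Lambda1 p ν ⧸ Ideal.span {ξ},
      (p : Lambda1 p ν ⧸ Ideal.span {ξ}) ^ (2 * ν + v) * y = 0) ∧
    Finite (Lambda1 p ν ⧸ Ideal.span {ξ}) := by
  have hpow : (p : Lambda1 p ν) ^ (2 * ν + v) ∈ Ideal.span {ξ} := by
    obtain ⟨u, rfl⟩ := PadicInt.exists_unit_of_norm_eq hc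
    rw [Ideal.mem_span_singleton']
    refine ⟨algebraMap ℤ_[p] (Lambda1 p ν) ↑u⁻¹ * (p : Lambda1 p ν) ^ ν, ?_⟩
    have hu : algebraMap ℤ_[p] (Lambda1 p ν) ↑u⁻¹ * algebraMap ℤ_[p] (Lambda1 p ν) u = 1 := by
      rw [← map_mul, Units.inv_mul, map_one]
    rw [hξ, map_mul, map_pow, map_natCast]
    linear_combination (p : Lambda1 p ν) ^ (2 * ν + v) * hu
      + algebraMap ℤ_[p] (Lambda1 p ν) ↑u⁻¹ * algebraMap ℤ_[p] (Lambda1 p ν) d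
        * Lambda1_pow_mul_X p ν
  have hzero : (p : Lambda1 p ν ⧸ Ideal.span {ξ}) ^ (2 * ν + v) = 0 := by
    rw [← Ideal.Quotient.eq_zero_iff_mem, map_pow, map_natCast] at hpow
    exact hpow
  refine ⟨fun y => (congrArg (· * y) hzero).trans (zero_mul y), ?_⟩
  refine PadicInt.finite_of_pow_eq_zero
    ((Ideal.Quotient.mk (Ideal.span {ξ})).comp (algebraMap ℤ_[p] (Lambda1 p ν)))
    (Ideal.Quotient.mk _ (Lambda1X p ν)) _ hzero fun y => ?_
  obtain ⟨z, rfl⟩ := Ideal.Quotient.mk_surjective y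
  obtain ⟨a, b, rfl⟩ := Lambda1_exists_eq_add_mul_X p ν z
  exact ⟨a, b, by simp only [map_add, map_mul, RingHom.comp_apply]⟩
end

section
/- Let ξ = c + d·X ∈ Λ₁ with c ∈ ℤ_p and d ∈ ℤ_p, and suppose X·ξ = 0 in Λ₁ and ξ does not lie in the ideal X·Λ₁ (equivalently: p^ν divides c and c ≠ 0). Then the ideal ξ·Λ₁ coincides with the set {a·ξ : a ∈ ℤ_p}, and the map ℤ_p → ξ·Λ₁ sending a to a·ξ is an isomorphism of ℤ_p-modules; in particular ξ·Λ₁ is a free ℤ_p-module of rank 1. -/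
/-- The augmentation `Λ₁ → ℤ_p` sending `X` to `0`. -/
noncomputable def Lambda1.augmentation (p : ℕ) [Fact p.Prime] (ν : ℕ) :
    Lambda1 p ν →ₐ[ℤ_[p]] ℤ_[p] :=
  Ideal.Quotient.liftₐ _ (Polynomial.aeval (0 : ℤ_[p])) fun f hf => by
    have hle : Ideal.span {(Polynomial.X : Polynomial ℤ_[p]) ^ 2,
        (p : Polynomial ℤ_[p]) ^ ν * Polynomial.X} ≤
        RingHom.ker (Polynomial.aeval (R := ℤ_[p]) (0 : ℤ_[p])) := by
      rw [Ideal.span_le]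
      rintro g (rfl | rfl) <;> simp [RingHom.mem_ker]
    exact hle hf

theorem Lambda1.augmentation_X (p : ℕ) [Fact p.Prime] (ν : ℕ) :
    Lambda1.augmentation p ν (Lambda1X p ν) = 0 :=
  Polynomial.aeval_X (R := ℤ_[p]) (0 : ℤ_[p])

theorem Lambda1.exists_eq_algebraMap_add_mul_X {p : ℕ} [Fact p.Prime] {ν : ℕ}
    (r : Lambda1 p ν) : ∃ (a : ℤ_[p]) (q : Lambda1 p ν),
      r = algebraMap ℤ_[p] (Lambda1 p ν) a + q * Lambda1X p ν := by
  obtain ⟨f, rfl⟩ := Ideal.Quotient.mk_surjective r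
  refine ⟨f.coeff 0, Ideal.Quotient.mk _ f.divX, ?_⟩
  conv_lhs => rw [← Polynomial.divX_mul_X_add f, map_add, map_mul, add_comm]
  rfl

/-- Let `ξ = c + d·X ∈ Λ₁` with `X·ξ = 0` and `ξ ∉ X·Λ₁`.  Then the
ideal `ξ·Λ₁` coincides with the set `{a·ξ : a ∈ ℤ_p}`, and the map `ℤ_p → ξ·Λ₁`,
`a ↦ a·ξ`, is an isomorphism of `ℤ_p`-modules; in particular `ξ·Λ₁` is a free
`ℤ_p`-module of rank 1. -/
theorem Lambda1_ideal_free_rank_one (p : ℕ) [Fact p.Prime] (ν : ℕ) (hν : 1 ≤ ν)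
    (c d : ℤ_[p]) (ξ : Lambda1 p ν)
    (hξ : ξ = algebraMap ℤ_[p] (Lambda1 p ν) c
      + algebraMap ℤ_[p] (Lambda1 p ν) d * Lambda1X p ν)
    (hXξ : Lambda1X p ν * ξ = 0)
    (hnot : ξ ∉ Ideal.span {Lambda1X p ν}) :
    (∀ y : Lambda1 p ν, y ∈ Ideal.span {ξ} ↔ ∃ a : ℤ_[p], y = a • ξ) ∧
    Function.Injective (fun a : ℤ_[p] => a • ξ) := by
  have hc : c ≠ 0 := by
    rintro rfl
    refine hnot (Ideal.mem_span_singleton'.2 ⟨algebraMap ℤ_[p] (Lambda1 p ν) d, ?_⟩)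
    rw [hξ, map_zero, zero_add]
  have haug : Lambda1.augmentation p ν ξ = c := by
    rw [hξ, map_add, map_mul, Lambda1.augmentation_X, mul_zero, add_zero, AlgHom.commutes]
    rfl
  refine ⟨fun y => ⟨fun hy => ?_, ?_⟩, fun a b hab => ?_⟩
  · obtain ⟨r, rfl⟩ := Ideal.mem_span_singleton'.1 hy
    obtain ⟨a, q, rfl⟩ := r.exists_eq_algebraMap_add_mul_X
    refine ⟨a, ?_⟩
    rw [add_mul, mul_assoc, hXξ, mul_zero, add_zero]
    exact (Algebra.smul_def a ξ).symm
  · rintro ⟨a, rfl⟩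
    exact Ideal.mem_span_singleton'.2
      ⟨algebraMap ℤ_[p] (Lambda1 p ν) a, (Algebra.smul_def a ξ).symm⟩
  · have h := congrArg (Lambda1.augmentation p ν) hab
    simp only [map_smul, haug, smul_eq_mul] at h
    exact mul_right_cancel₀ hc h
end

section
/- Let p be a prime and m ≥ 1 an integer. Let A be a commutative local ring that is free of finite rank as a ℤ_p-module, and let t ∈ A be an element that generates A as a ℤ_p-algebra. Suppose that the natural ℤ_p-algebra surjection ℤ_p → A/(t) has kernel p^m ℤ_p (so A/(t) ≅ ℤ/p^mℤ), and suppose there exists a ring homomorphism φ : A → ℤ/p^{2m}ℤ such that φ(t) = v·p^m for some unit v of ℤ/p^{2m}ℤ. Then the structure map ℤ_p → A is surjective; that is, A is free of rank 1 over ℤ_p. -/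
/-- Every element of an algebra generated by `t` is a scalar plus a multiple of `t`. -/
theorem exists_eq_algebraMap_add_mul_of_adjoin_eq_top {R A : Type*} [CommRing R] [CommRing A]
    [Algebra R A] {t : A} (hgen : Algebra.adjoin R {t} = ⊤) (x : A) :
    ∃ (a : R) (h : A), x = algebraMap R A a + t * h := by
  have hx : x ∈ Algebra.adjoin R {t} := hgen ▸ Algebra.mem_top
  induction hx using Algebra.adjoin_induction with
  | mem x hx => exact ⟨0, 1, by simp [Set.mem_singleton_iff.mp hx]⟩
  | algebraMap r => exact ⟨r, 0, by simp⟩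
  | add x y _ _ hx hy =>
    obtain ⟨a, h, rfl⟩ := hx
    obtain ⟨b, k, rfl⟩ := hy
    exact ⟨a + b, h + k, by rw [map_add]; ring⟩
  | mul x y _ _ hx hy =>
    obtain ⟨a, h, rfl⟩ := hx
    obtain ⟨b, k, rfl⟩ := hy
    exact ⟨a * b, algebraMap R A a * k + algebraMap R A b * h + t * h * k, by
      rw [map_mul]; ring⟩

/-- A finite algebra all of whose elements are scalars modulo an ideal contained in the Jacobson
radical of the base is a quotient of the base. -/
theorem algebraMap_surjective_of_forall_exists_sub_mem {R A : Type*} [CommRing R] [CommRing A]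
    [Algebra R A] [Module.Finite R A] {I : Ideal R} (hI : I ≤ Ideal.jacobson ⊥)
    (h : ∀ x : A, ∃ a : R, x - algebraMap R A a ∈ I • (⊤ : Submodule R A)) :
    Function.Surjective (algebraMap R A) := by
  have htop : (⊤ : Submodule R A) ≤ LinearMap.range (Algebra.linearMap R A) := by
    refine Submodule.le_of_le_smul_of_le_jacobson_bot Module.Finite.fg_top hI fun x _ => ?_
    obtain ⟨a, ha⟩ := h x
    exact Submodule.mem_sup.mpr ⟨algebraMap R A a, ⟨a, rfl⟩, _, ha, by ring⟩
  exact fun x => htop (Submodule.mem_top (x := x))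

/-- Let `A` be a commutative local ring, free of finite rank as a
`ℤ_p`-module, generated as a `ℤ_p`-algebra by an element `t`.  Suppose the kernel of
the natural map `ℤ_p → A/(t)` is `p^m ℤ_p`, and suppose there is a ring homomorphism
`φ : A → ℤ/p^{2m}ℤ` with `φ(t) = v·p^m` for a unit `v`.  Then `ℤ_p → A` is
surjective, i.e. `A` is free of rank 1 over `ℤ_p`. -/
theorem local_ring_gen_is_Zp (p : ℕ) [Fact p.Prime] (m : ℕ) (hm : 1 ≤ m)
    (A : Type) [CommRing A] [IsLocalRing A] [Algebra ℤ_[p] A]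
    [Module.Free ℤ_[p] A] [Module.Finite ℤ_[p] A]
    (t : A) (hgen : Algebra.adjoin ℤ_[p] {t} = ⊤)
    (hker : RingHom.ker ((Ideal.Quotient.mk (Ideal.span {t})).comp
        (algebraMap ℤ_[p] A)) = Ideal.span {(p : ℤ_[p]) ^ m})
    (φ : A →+* ZMod (p ^ (2 * m))) (v : (ZMod (p ^ (2 * m)))ˣ)
    (hφt : φ t = (v : ZMod (p ^ (2 * m))) * (p : ZMod (p ^ (2 * m))) ^ m) :
    Function.Surjective (algebraMap ℤ_[p] A) := by
  have hp : p.Prime := Fact.out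
  have hpm : (p : ZMod (p ^ (2 * m))) ^ m ≠ 0 := by
    rw [← Nat.cast_pow, Ne, ZMod.natCast_eq_zero_iff, Nat.pow_dvd_pow_iff_le_right hp.one_lt]
    omega
  have : Nontrivial (ZMod (p ^ (2 * m))) := ⟨_, _, hpm⟩
  have hnil : IsNilpotent (p : ZMod (p ^ (2 * m))) :=
    ⟨2 * m, by rw [← Nat.cast_pow, ZMod.natCast_self]⟩
  have hφt_nil : IsNilpotent (φ t) := by
    rw [hφt]
    exact (Commute.all _ _).isNilpotent_mul_left (hnil.pow_of_pos (by omega))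
  have ht : t ∈ IsLocalRing.maximalIdeal A := by
    rw [IsLocalRing.mem_maximalIdeal]
    exact fun h => hφt_nil.not_isUnit (h.map φ)
  obtain ⟨y, hy⟩ : t ∣ (p : A) ^ m := by
    have hmem : (p : ℤ_[p]) ^ m ∈ RingHom.ker ((Ideal.Quotient.mk (Ideal.span {t})).comp
        (algebraMap ℤ_[p] A)) := hker ▸ Ideal.mem_span_singleton_self _
    rw [RingHom.mem_ker, RingHom.comp_apply, Ideal.Quotient.eq_zero_iff_mem,
      Ideal.mem_span_singleton] at hmem
    simpa using hmem
  have hφy : ¬ IsNilpotent (φ y) := by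
    intro hn
    have hu : IsUnit (1 - v * φ y) :=
      ((Commute.all _ _).isNilpotent_mul_left hn).isUnit_one_sub
    have h := congrArg φ hy
    rw [map_pow, map_natCast, map_mul, hφt] at h
    exact hpm (hu.mul_left_eq_zero.mp (by linear_combination h))
  obtain ⟨a, h, rfl⟩ := exists_eq_algebraMap_add_mul_of_adjoin_eq_top hgen y
  have ha : IsUnit a := by
    by_contra hna
    have hmem : a ∈ IsLocalRing.maximalIdeal ℤ_[p] := hna
    rw [PadicInt.maximalIdeal_eq_span_p, Ideal.mem_span_singleton] at hmem
    obtain ⟨b, rfl⟩ := hmem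
    apply hφy
    simp only [map_add, map_mul, map_natCast]
    exact (Commute.all _ _).isNilpotent_add ((Commute.all _ _).isNilpotent_mul_right hnil)
      ((Commute.all _ _).isNilpotent_mul_right hφt_nil)
  have hy_unit : IsUnit (algebraMap ℤ_[p] A a + t * h) := by
    by_contra hny
    have hsub := sub_mem ((IsLocalRing.mem_maximalIdeal _).mpr hny) (Ideal.mul_mem_right h _ ht)
    rw [add_sub_cancel_right, IsLocalRing.mem_maximalIdeal] at hsub
    exact hsub (ha.map _)
  obtain ⟨s, hs⟩ : (p : A) ∣ t :=
    (dvd_pow_self _ (Nat.one_le_iff_ne_zero.mp hm)).trans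
      (hy ▸ hy_unit.mul_right_dvd.mpr dvd_rfl)
  refine algebraMap_surjective_of_forall_exists_sub_mem
    (IsLocalRing.maximalIdeal_le_jacobson ⊥) fun x => ?_
  obtain ⟨b, k, rfl⟩ := exists_eq_algebraMap_add_mul_of_adjoin_eq_top hgen x
  refine ⟨b, ?_⟩
  have hpmem : (p : ℤ_[p]) ∈ IsLocalRing.maximalIdeal ℤ_[p] := by
    rw [PadicInt.maximalIdeal_eq_span_p]
    exact Ideal.mem_span_singleton_self _
  have hk : algebraMap ℤ_[p] A b + t * k - algebraMap ℤ_[p] A b = (p : ℤ_[p]) • (s * k) := by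
    rw [Algebra.smul_def (p : ℤ_[p]), map_natCast, add_sub_cancel_left, ← mul_assoc, ← hs]
  exact hk ▸ Submodule.smul_mem_smul hpmem Submodule.mem_top
end

section
/- The ℤ_p-algebra homomorphism φ : Λ → ℤ_p[X]/(X², p^ν X) defined on group-algebra basis elements by φ([g^j]) = 1 + j̃·X, where j̃ ∈ {0,…,p^ν−1} is the representative of j mod p^ν, is a well-defined surjective ring homomorphism whose kernel is I². Consequently Λ/I² is isomorphic as a ℤ_p-algebra to ℤ_p[X]/(X², p^ν X). -/
/-- If `x ^ 2 = 0` then `(1 + x) ^ n = 1 + n x`. -/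
theorem one_add_pow_of_sq_eq_zero {R : Type*} [CommRing R] {x : R} (hx : x ^ 2 = 0) (n : ℕ) :
    (1 + x) ^ n = 1 + n * x := by
  induction n with
  | zero => simp
  | succ n ih =>
    rw [pow_succ, ih]
    push_cast
    linear_combination (n : R) * hx

theorem Lambda1X_sq (p : ℕ) [Fact p.Prime] (ν : ℕ) : Lambda1X p ν ^ 2 = 0 :=
  Ideal.Quotient.eq_zero_iff_mem.mpr (Ideal.subset_span (Set.mem_insert _ _))

theorem natCast_mul_Lambda1X (p : ℕ) [Fact p.Prime] (ν : ℕ) :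
    ((p ^ ν : ℕ) : Lambda1 p ν) * Lambda1X p ν = 0 := by
  have h : (p : Polynomial ℤ_[p]) ^ ν * Polynomial.X ∈
      Ideal.span {(Polynomial.X : Polynomial ℤ_[p]) ^ 2,
        (p : Polynomial ℤ_[p]) ^ ν * Polynomial.X} :=
    Ideal.subset_span (Set.mem_insert_of_mem _ rfl)
  simpa using Ideal.Quotient.eq_zero_iff_mem.mpr h

theorem one_add_Lambda1X_pow (p : ℕ) [Fact p.Prime] (ν n : ℕ) :
    (1 + Lambda1X p ν) ^ n = 1 + (n : Lambda1 p ν) * Lambda1X p ν :=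
  one_add_pow_of_sq_eq_zero (Lambda1X_sq p ν) n

/-- A cyclic group of order `p ^ ν` with generator `g` maps to `Λ₁` by `g ↦ 1 + X`. -/
theorem exists_monoidHom_Lambda1 (p : ℕ) [Fact p.Prime] (ν : ℕ) {G : Type*} [CommGroup G]
    (hG : Nat.card G = p ^ ν) {g : G} (hg : ∀ x : G, x ∈ Subgroup.zpowers g) :
    ∃ f : G →* Lambda1 p ν, f g = 1 + Lambda1X p ν := by
  have hu : (1 + Lambda1X p ν) ^ p ^ ν = 1 := by
    rw [one_add_Lambda1X_pow, natCast_mul_Lambda1X, add_zero]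
  let u : (Lambda1 p ν)ˣ :=
    Units.ofPowEqOne _ (p ^ ν) hu (pow_pos (Fact.out : p.Prime).pos ν).ne'
  have ho : orderOf u ∣ orderOf g := by
    rw [orderOf_eq_card_of_forall_mem_zpowers hg, hG]
    exact orderOf_dvd_of_pow_eq_one (Units.pow_ofPowEqOne hu _)
  refine ⟨(Units.coeHom _).comp (monoidHomOfForallMemZpowers hg ho), ?_⟩
  simp [u]

/-- An algebra homomorphism from `ℤ_p[G]` to `Λ₁` with `g ↦ 1 + X` agrees with the augmentation
modulo `X`. -/
theorem exists_eq_augmentation_add_Lambda1X_mul (p : ℕ) [Fact p.Prime] (ν : ℕ)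
    {G : Type*} [CommGroup G] [Finite G] {g : G} (hg : ∀ x : G, x ∈ Subgroup.zpowers g)
    (ε : MonoidAlgebra ℤ_[p] G →ₐ[ℤ_[p]] ℤ_[p])
    (hε : ∀ x : G, ε (MonoidAlgebra.of ℤ_[p] G x) = 1)
    (φ : MonoidAlgebra ℤ_[p] G →ₐ[ℤ_[p]] Lambda1 p ν)
    (hφ : φ (MonoidAlgebra.of ℤ_[p] G g) = 1 + Lambda1X p ν) (a : MonoidAlgebra ℤ_[p] G) :
    ∃ c, φ a = algebraMap _ _ (ε a) + Lambda1X p ν * c := by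
  induction a using MonoidAlgebra.induction_on with
  | of x =>
    obtain ⟨n, rfl⟩ := mem_powers_iff_mem_zpowers.mpr (hg x)
    refine ⟨n, ?_⟩
    simp only [hε]
    simp only [map_pow, hφ, map_one, one_add_Lambda1X_pow]
    ring
  | add a b ha hb =>
    obtain ⟨c, hc⟩ := ha
    obtain ⟨d, hd⟩ := hb
    refine ⟨c + d, ?_⟩
    simp only [map_add, hc, hd]
    ring
  | smul r a ha =>
    obtain ⟨c, hc⟩ := ha
    refine ⟨algebraMap _ _ r * c, ?_⟩
    rw [Algebra.smul_def, map_mul, map_mul, AlgHom.commutes, AlgHom.commutes, hc, map_mul,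
      Algebra.algebraMap_self_apply]
    ring

/-- Let `G` be cyclic of order `p^ν` with generator `g`, `Λ = ℤ_p[G]`,
`I` the augmentation ideal.  The `ℤ_p`-algebra homomorphism `φ : Λ → ℤ_p[X]/(X², p^ν X)`
with `φ([g^j]) = 1 + j̃·X` (where `j̃ ∈ {0,…,p^ν−1}` represents `j mod p^ν`) is a
well-defined surjective ring homomorphism with kernel `I²`; consequently
`Λ/I² ≅ ℤ_p[X]/(X², p^ν X)` as `ℤ_p`-algebras. -/
theorem group_algebra_mod_I_sq (p : ℕ) [Fact p.Prime] (ν : ℕ) (hν : 1 ≤ ν)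
    (G : Type) [CommGroup G] (hG : Nat.card G = p ^ ν)
    (g : G) (hg : ∀ x : G, x ∈ Subgroup.zpowers g)
    (ε : MonoidAlgebra ℤ_[p] G →ₐ[ℤ_[p]] ℤ_[p])
    (hε : ∀ x : G, ε (MonoidAlgebra.of ℤ_[p] G x) = 1) :
    (∃ φ : MonoidAlgebra ℤ_[p] G →ₐ[ℤ_[p]] Lambda1 p ν,
      (∀ j : ZMod (p ^ ν),
        φ (MonoidAlgebra.of ℤ_[p] G (g ^ j.val))
          = 1 + (j.val : Lambda1 p ν) * Lambda1X p ν) ∧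
      Function.Surjective φ ∧
      RingHom.ker φ.toRingHom = (RingHom.ker ε.toRingHom) ^ 2) ∧
    Nonempty ((MonoidAlgebra ℤ_[p] G ⧸ (RingHom.ker ε.toRingHom) ^ 2)
      ≃ₐ[ℤ_[p]] Lambda1 p ν) := by
  have hpos : 0 < p ^ ν := pow_pos (Fact.out : p.Prime).pos ν
  have : Finite G := Nat.finite_of_card_ne_zero (hG ▸ hpos.ne')
  obtain ⟨f, hf⟩ := exists_monoidHom_Lambda1 p ν hG hg
  set I := RingHom.ker ε.toRingHom
  let φ : MonoidAlgebra ℤ_[p] G →ₐ[ℤ_[p]] Lambda1 p ν := MonoidAlgebra.lift _ _ _ f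
  have hφg : φ (MonoidAlgebra.of ℤ_[p] G g) = 1 + Lambda1X p ν := by
    simp [φ, hf]
  have hφpow (n : ℕ) : φ (MonoidAlgebra.of ℤ_[p] G (g ^ n)) =
      1 + (n : Lambda1 p ν) * Lambda1X p ν := by
    rw [map_pow, map_pow, hφg, one_add_Lambda1X_pow]
  have hφI : ∀ a ∈ I ^ 2, φ a = 0 := by
    suffices h : I ^ 2 ≤ RingHom.ker φ from fun a ha => h ha
    rw [pow_two, Ideal.mul_le]
    intro a ha b hb
    obtain ⟨c, hc⟩ := exists_eq_augmentation_add_Lambda1X_mul p ν hg ε hε φ hφg a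
    obtain ⟨d, hd⟩ := exists_eq_augmentation_add_Lambda1X_mul p ν hg ε hε φ hφg b
    have ha' : ε a = 0 := ha
    have hb' : ε b = 0 := hb
    rw [RingHom.mem_ker, map_mul, hc, hd, ha', hb', map_zero]
    linear_combination c * d * Lambda1X_sq p ν
  let π := Ideal.Quotient.mkₐ ℤ_[p] (I ^ 2)
  let t : MonoidAlgebra ℤ_[p] G ⧸ I ^ 2 := π (MonoidAlgebra.of ℤ_[p] G g - 1)
  have ht : t ^ 2 = 0 := by
    rw [← map_pow]
    refine Ideal.Quotient.eq_zero_iff_mem.mpr (Ideal.pow_mem_pow ?_ 2)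
    change ε _ = 0
    rw [map_sub, hε, map_one, sub_self]
  have hπpow (n : ℕ) : π (MonoidAlgebra.of ℤ_[p] G (g ^ n)) = 1 + n * t := by
    have h : π (MonoidAlgebra.of ℤ_[p] G g) = 1 + t := by
      simp only [t, map_sub, map_one, add_sub_cancel]
    rw [← one_add_pow_of_sq_eq_zero ht, map_pow, map_pow, h]
  have htN : ((p ^ ν : ℕ) : MonoidAlgebra ℤ_[p] G ⧸ I ^ 2) * t = 0 := by
    have h := hπpow (p ^ ν)
    rw [← hG, pow_card_eq_one', map_one, map_one, hG] at h
    exact left_eq_add.mp h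
  let ψ : Lambda1 p ν →ₐ[ℤ_[p]] MonoidAlgebra ℤ_[p] G ⧸ I ^ 2 :=
    Ideal.Quotient.liftₐ _ (Polynomial.aeval t) (by
      suffices h : Ideal.span {(Polynomial.X : Polynomial ℤ_[p]) ^ 2,
          (p : Polynomial ℤ_[p]) ^ ν * Polynomial.X} ≤ RingHom.ker (Polynomial.aeval t) from
        fun a ha => h ha
      rw [Ideal.span_le]
      rintro _ (rfl | rfl)
      · simpa using ht
      · simpa using htN)
  have hψX : ψ (Lambda1X p ν) = t :=
    (Ideal.Quotient.lift_mk _ _ _).trans (Polynomial.aeval_X t)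
  let φ' : (MonoidAlgebra ℤ_[p] G ⧸ I ^ 2) →ₐ[ℤ_[p]] Lambda1 p ν :=
    Ideal.Quotient.liftₐ _ φ hφI
  have hφ' (a : MonoidAlgebra ℤ_[p] G) : φ' (π a) = φ a := rfl
  let e : (MonoidAlgebra ℤ_[p] G ⧸ I ^ 2) ≃ₐ[ℤ_[p]] Lambda1 p ν :=
    AlgEquiv.ofAlgHom φ' ψ
      (by
        refine Ideal.Quotient.algHom_ext _ (Polynomial.algHom_ext ?_)
        change φ' (ψ (Lambda1X p ν)) = Lambda1X p ν
        rw [hψX, hφ', map_sub, hφg, map_one, add_sub_cancel_left])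
      (by
        refine Ideal.Quotient.algHom_ext _ (MonoidAlgebra.algHom_ext (fun x => ?_)
          (Subsingleton.elim _ _))
        obtain ⟨n, rfl⟩ := mem_powers_iff_mem_zpowers.mpr (hg x)
        change ψ (φ' (π (MonoidAlgebra.of ℤ_[p] G (g ^ n)))) =
          π (MonoidAlgebra.of ℤ_[p] G (g ^ n))
        rw [hφ', hφpow, hπpow, map_add, map_mul, map_one, map_natCast, hψX])
  refine ⟨⟨φ, fun j => hφpow j.val, ?_, ?_⟩, ⟨e⟩⟩
  · exact e.surjective.comp (Ideal.Quotient.mkₐ_surjective ℤ_[p] (I ^ 2))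
  · refine le_antisymm (fun a ha => ?_) hφI
    have h : e (π a) = 0 := ha
    exact Ideal.Quotient.eq_zero_iff_mem.mp ((map_eq_zero_iff e e.injective).mp h)
end
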